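/- Let (A^1, …, A^N, r^1, …, r^N) be a monotone N-player finite normal-form game, η > 0, and μ̄ an interior strategy profile. Define the transformed values Ṽ^i(π) = V^i(π) − η·KL(π^i, μ̄^i), and let π* be an interior Nash equilibrium of the transformed game. Let t ↦ y_t be differentiable FoReL dynamics for the transformed game: π_t^i = softmax(y_t^i) and d/dt y_t^i(a) = Q^i_{π_t}(a) − η log(π_t^i(a)/μ̄^i(a)), where Q^i is the Q-function of the original game. Then for all t ≥ 0, d/dt J_{π*}(y_t) ≤ −η Σ_{i=1}^N KL(π*^i, π_t^i). -/

import Mathlib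

open Finset

/-- A probability vector on a finite set: nonnegative entries summing to 1. -/
def IsMixed {α : Type*} [Fintype α] (p : α → ℝ) : Prop :=
  (∀ a, 0 ≤ p a) ∧ ∑ a, p a = 1

/-- A strictly positive (interior) vector. -/
def IsInterior {α : Type*} [Fintype α] (p : α → ℝ) : Prop :=
  ∀ a, 0 < p a

/-- Kullback–Leibler divergence `KL(p, q) = Σ_a p(a) log(p(a)/q(a))`. -/
noncomputable def KL {α : Type*} [Fintype α] (p q : α → ℝ) : ℝ :=
  ∑ a, p a * Real.log (p a / q a)

/-- `softmax(y)(a) = exp(y(a)) / Σ_b exp(y(b))`. -/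
noncomputable def softmax {α : Type*} [Fintype α] (y : α → ℝ) (a : α) : ℝ :=
  Real.exp (y a) / ∑ b, Real.exp (y b)

/-- Expected payoff `V^i(π)` of player `i` in an N-player finite normal-form game. -/
noncomputable def Vfun {ι : Type*} [Fintype ι] [DecidableEq ι]
    {A : ι → Type*} [∀ i, Fintype (A i)]
    (r : (∀ j, A j) → ℝ) (π : ∀ j, A j → ℝ) : ℝ :=
  ∑ a : ∀ j, A j, (∏ j, π j (a j)) * r a

/-- `Ω^i(π, μ) = V^i(π) − V^i(μ^i, π^{-i}) − V^i(π^i, μ^{-i}) + V^i(μ)`. -/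
noncomputable def Omega {ι : Type*} [Fintype ι] [DecidableEq ι]
    {A : ι → Type*} [∀ i, Fintype (A i)]
    (r : ι → (∀ j, A j) → ℝ) (i : ι) (π μ : ∀ j, A j → ℝ) : ℝ :=
  Vfun (r i) π - Vfun (r i) (Function.update π i (μ i))
    - Vfun (r i) (Function.update μ i (π i)) + Vfun (r i) μ

/-- `Q^i_π(a)`: the expected payoff to player `i` of playing action `a` against `π^{-i}`. -/
noncomputable def Qfun {ι : Type*} [Fintype ι] [DecidableEq ι]
    {A : ι → Type*} [∀ i, Fintype (A i)] [∀ i, DecidableEq (A i)]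
    (r : (∀ j, A j) → ℝ) (π : ∀ j, A j → ℝ) (i : ι) (a : A i) : ℝ :=
  Vfun r (Function.update π i (fun a' => if a' = a then (1 : ℝ) else 0))

theorem Vfun_update_eq_sum_mul_Qfun {ι : Type*} [Fintype ι] [DecidableEq ι]
    {A : ι → Type*} [∀ i, Fintype (A i)] [∀ i, DecidableEq (A i)]
    (r : (∀ j, A j) → ℝ) (π : ∀ j, A j → ℝ) (i : ι) (p : A i → ℝ) :
    Vfun r (Function.update π i p) = ∑ a, p a * Qfun r π i a := by
  have key : ∀ (q : A i → ℝ) (x : ∀ j, A j),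
      ∏ j, Function.update π i q j (x j) = q (x i) * ∏ j ∈ univ.erase i, π j (x j) := by
    intro q x
    rw [← Finset.mul_prod_erase univ _ (mem_univ i), Function.update_self]
    congr 1
    refine Finset.prod_congr rfl fun j hj => ?_
    rw [Function.update_of_ne (Finset.ne_of_mem_erase hj)]
  simp only [Qfun, Vfun, key, Finset.mul_sum]
  rw [Finset.sum_comm]
  refine Finset.sum_congr rfl fun x _ => ?_
  simp [ite_mul, mul_ite, mul_assoc]

theorem Vfun_eq_sum_mul_Qfun {ι : Type*} [Fintype ι] [DecidableEq ι]
    {A : ι → Type*} [∀ i, Fintype (A i)] [∀ i, DecidableEq (A i)]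
    (r : (∀ j, A j) → ℝ) (π : ∀ j, A j → ℝ) (i : ι) :
    Vfun r π = ∑ a, π i a * Qfun r π i a := by
  rw [← Vfun_update_eq_sum_mul_Qfun, Function.update_eq_self]

theorem softmax_pos {α : Type*} [Fintype α] [Nonempty α] (y : α → ℝ) (a : α) :
    0 < softmax y a :=
  div_pos (Real.exp_pos _) (Finset.sum_pos (fun _ _ => Real.exp_pos _) univ_nonempty)

theorem isMixed_softmax {α : Type*} [Fintype α] [Nonempty α] (y : α → ℝ) :
    IsMixed (softmax y) := by
  refine ⟨fun a => (softmax_pos y a).le, ?_⟩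
  simp only [softmax]
  rw [← Finset.sum_div]
  exact div_self (Finset.sum_pos (fun _ _ => Real.exp_pos _) univ_nonempty).ne'

/-- The chi-square upper bound for the Kullback–Leibler divergence. -/
theorem KL_le_sum_sq_div {α : Type*} [Fintype α] {p q : α → ℝ} (hp : IsMixed p)
    (hq : IsMixed q) (hqI : IsInterior q) : KL p q ≤ ∑ a, (p a - q a) ^ 2 / q a := by
  have h : ∀ a, p a * Real.log (p a / q a) ≤ (p a - q a) ^ 2 / q a + (p a - q a) := by
    intro a
    have hqa := hqI a
    calc p a * Real.log (p a / q a) ≤ p a * (p a / q a - 1) := by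
          rcases (hp.1 a).eq_or_lt with h0 | h0
          · simp [← h0]
          · exact mul_le_mul_of_nonneg_left
              (Real.log_le_sub_one_of_pos (div_pos h0 hqa)) h0.le
      _ = (p a - q a) ^ 2 / q a + (p a - q a) := by field_simp; ring
  calc KL p q ≤ ∑ a, ((p a - q a) ^ 2 / q a + (p a - q a)) := Finset.sum_le_sum fun a _ => h a
    _ = ∑ a, (p a - q a) ^ 2 / q a := by
      rw [Finset.sum_add_distrib, Finset.sum_sub_distrib, hp.2, hq.2]; ring

theorem KL_nonneg {α : Type*} [Fintype α] {p q : α → ℝ} (hp : IsMixed p)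
    (hq : IsMixed q) (hpI : IsInterior p) (hqI : IsInterior q) : 0 ≤ KL p q := by
  have h : ∀ a, p a - q a ≤ p a * Real.log (p a / q a) := by
    intro a
    have hpa := hpI a
    have h1 := Real.one_sub_inv_le_log_of_pos (div_pos hpa (hqI a))
    have h2 := mul_le_mul_of_nonneg_left h1 hpa.le
    have h3 : p a * (1 - (p a / q a)⁻¹) = p a - q a := by field_simp
    linarith
  have := Finset.sum_le_sum fun a (_ : a ∈ univ) => h a
  rw [Finset.sum_sub_distrib, hp.2, hq.2] at this
  simpa [KL] using this

/-- The three-point identity for the Kullback–Leibler divergence. -/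
theorem KL_sub_KL_eq {α : Type*} [Fintype α] {p q m : α → ℝ} (hp : ∀ a, 0 ≤ p a)
    (hqI : IsInterior q) (hmI : IsInterior m) :
    KL p m - KL q m = KL p q + ∑ a, (p a - q a) * Real.log (q a / m a) := by
  simp only [KL]
  rw [← Finset.sum_sub_distrib, ← Finset.sum_add_distrib]
  refine Finset.sum_congr rfl fun a _ => ?_
  rcases (hp a).eq_or_lt with h0 | h0
  · simp [← h0]
  · rw [Real.log_div h0.ne' (hmI a).ne', Real.log_div h0.ne' (hqI a).ne',
      Real.log_div (hqI a).ne' (hmI a).ne']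
    ring

/-- First-order optimality condition for a linear objective regularized by `KL · m`. -/
theorem sum_sub_mul_le_of_forall_KL_regularized_le {α : Type*} [Fintype α]
    {q m c : α → ℝ} {η : ℝ} (hη : 0 < η) (hq : IsMixed q) (hqI : IsInterior q)
    (hmI : IsInterior m)
    (hmax : ∀ p, IsMixed p → ∑ a, p a * c a - η * KL p m ≤ ∑ a, q a * c a - η * KL q m)
    {p : α → ℝ} (hp : IsMixed p) :
    ∑ a, (p a - q a) * c a ≤ η * ∑ a, (p a - q a) * Real.log (q a / m a) := by
  set D := ∑ a, (p a - q a) * c a with hD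
  set E := ∑ a, (p a - q a) * Real.log (q a / m a) with hE
  set C := ∑ a, (p a - q a) ^ 2 / q a with hC
  have key : ∀ s : ℝ, 0 < s → s < 1 → D ≤ η * (s * C + E) := by
    intro s hs hs1
    set w : α → ℝ := fun a => q a + s * (p a - q a) with hw
    have hwm : IsMixed w := by
      refine ⟨fun a => ?_, ?_⟩
      · have h1 := mul_nonneg hs.le (hp.1 a)
        have h2 := mul_nonneg (sub_nonneg.2 hs1.le) (hq.1 a)
        simp only [hw]
        linarith
      · simp only [hw]
        rw [Finset.sum_add_distrib, ← Finset.mul_sum, Finset.sum_sub_distrib, hp.2, hq.2]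
        ring
    have e1 : ∑ a, w a * c a = ∑ a, q a * c a + s * D := by
      rw [hD, Finset.mul_sum, ← Finset.sum_add_distrib]
      exact Finset.sum_congr rfl fun a _ => by simp only [hw]; ring
    have e2 : ∑ a, (w a - q a) * Real.log (q a / m a) = s * E := by
      rw [hE, Finset.mul_sum]
      exact Finset.sum_congr rfl fun a _ => by simp only [hw]; ring
    have e3 : ∑ a, (w a - q a) ^ 2 / q a = s ^ 2 * C := by
      rw [hC, Finset.mul_sum]
      exact Finset.sum_congr rfl fun a _ => by simp only [hw]; ring
    have h1 := hmax w hwm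
    have h2 := KL_sub_KL_eq hwm.1 hqI hmI
    have h3 := KL_le_sum_sq_div hwm hq hqI
    rw [e1] at h1
    rw [e2] at h2
    rw [e3] at h3
    have h4 : η * (KL w m - KL q m) ≤ η * (s ^ 2 * C + s * E) :=
      mul_le_mul_of_nonneg_left (by linarith) hη.le
    refine le_of_mul_le_mul_left (a := s) ?_ hs
    linarith
  have hlim : Filter.Tendsto (fun s : ℝ => η * (s * C + E)) (nhdsWithin 0 (Set.Ioi 0))
      (nhds (η * E)) := by
    have hc : Continuous fun s : ℝ => η * (s * C + E) := by fun_prop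
    simpa using (hc.tendsto 0).mono_left nhdsWithin_le_nhds
  refine ge_of_tendsto hlim ?_
  filter_upwards [Ioo_mem_nhdsGT (zero_lt_one (α := ℝ))] with s hs
  exact key s hs.1 hs.2

theorem sum_sub_mul_log_sub_log_eq {α : Type*} [Fintype α] {p q m : α → ℝ}
    (hpI : IsInterior p) (hqI : IsInterior q) (hmI : IsInterior m) :
    ∑ a, (p a - q a) * Real.log (q a / m a) - ∑ a, (p a - q a) * Real.log (p a / m a)
      = -KL p q - KL q p := by
  simp only [KL]
  rw [← Finset.sum_sub_distrib, ← Finset.sum_neg_distrib, ← Finset.sum_sub_distrib]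
  refine Finset.sum_congr rfl fun a _ => ?_
  rw [Real.log_div (hpI a).ne' (hmI a).ne', Real.log_div (hpI a).ne' (hqI a).ne',
    Real.log_div (hqI a).ne' (hmI a).ne', Real.log_div (hqI a).ne' (hpI a).ne']
  ring

theorem hasDerivAt_log_sum_exp_sub_sum_mul {α : Type*} [Fintype α] [Nonempty α]
    {y : ℝ → α → ℝ} {y' : α → ℝ} {t : ℝ} (hy : ∀ a, HasDerivAt (fun s => y s a) (y' a) t)
    (q : α → ℝ) :
    HasDerivAt (fun s => Real.log (∑ a, Real.exp (y s a)) - ∑ a, q a * y s a)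
      (∑ a, (softmax (y t) a - q a) * y' a) t := by
  have h1 : HasDerivAt (fun s => ∑ a, Real.exp (y s a)) (∑ a, Real.exp (y t a) * y' a) t :=
    HasDerivAt.fun_sum fun a _ => (hy a).exp
  have h2 : HasDerivAt (fun s => ∑ a, q a * y s a) (∑ a, q a * y' a) t :=
    HasDerivAt.fun_sum fun a _ => (hy a).const_mul (q a)
  refine ((h1.log (Finset.sum_pos (fun _ _ => Real.exp_pos _) univ_nonempty).ne').sub
    h2).congr_deriv ?_
  rw [Finset.sum_div, ← Finset.sum_sub_distrib]
  refine Finset.sum_congr rfl fun a _ => ?_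
  simp only [softmax]
  ring

/-- In a monotone game with the transformed values `Ṽ^i(π) = V^i(π) − η·KL(π^i, μ̄^i)`,
FoReL dynamics for the transformed game make `J_{π*}` decrease at rate at least
`η Σ_i KL(π*^i, π_t^i)`, where `π*` is an interior Nash equilibrium of the
transformed game. -/
theorem deriv_J_le_neg_eta_KL_monotone_transform
    {ι : Type*} [Fintype ι] [DecidableEq ι]
    {A : ι → Type*} [∀ i, Fintype (A i)] [∀ i, DecidableEq (A i)] [∀ i, Nonempty (A i)]
    (r : ι → (∀ j, A j) → ℝ)
    (hmono : ∀ π μ : ∀ j, A j → ℝ, (∀ i, IsMixed (π i)) → (∀ i, IsMixed (μ i)) →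
      ∑ i, Omega r i π μ ≤ 0)
    (η : ℝ) (hη : 0 < η)
    (m : ∀ i, A i → ℝ) (hm : ∀ i, IsMixed (m i)) (hmI : ∀ i, IsInterior (m i))
    (st : ∀ j, A j → ℝ) (hst : ∀ i, IsMixed (st i)) (hstI : ∀ i, IsInterior (st i))
    (hN : ∀ i (p : A i → ℝ), IsMixed p →
      Vfun (r i) (Function.update st i p) - η * KL p (m i) ≤
        Vfun (r i) st - η * KL (st i) (m i))
    (y : ℝ → ∀ i, A i → ℝ)
    (hy : ∀ t i a, HasDerivAt (fun s => y s i a)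
      (Qfun (r i) (fun j => softmax (y t j)) i a
        - η * Real.log (softmax (y t i) a / m i a)) t) :
    ∀ t ≥ (0 : ℝ), ∃ d : ℝ,
      HasDerivAt (fun s => ∑ i,
        (Real.log (∑ a, Real.exp (y s i a)) - ∑ a, st i a * y s i a)) d t ∧
      d ≤ - η * ∑ i, KL (st i) (softmax (y t i)) := by
  intro t _
  set π : ∀ j, A j → ℝ := fun j => softmax (y t j) with hπ
  have hπm : ∀ i, IsMixed (π i) := fun i => isMixed_softmax _
  have hπI : ∀ i, IsInterior (π i) := fun i => softmax_pos _
  refine ⟨_, HasDerivAt.fun_sum fun i _ =>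
    hasDerivAt_log_sum_exp_sub_sum_mul (hy t i) (st i), ?_⟩
  have hQ : ∀ i, ∑ a, (π i a - st i a) * Qfun (r i) π i a
      = Omega r i π st + ∑ a, (π i a - st i a) * Qfun (r i) st i a := by
    intro i
    simp only [Omega, sub_mul, Finset.sum_sub_distrib]
    rw [← Vfun_eq_sum_mul_Qfun, ← Vfun_eq_sum_mul_Qfun, ← Vfun_update_eq_sum_mul_Qfun,
      ← Vfun_update_eq_sum_mul_Qfun]
    ring
  have hopt : ∀ i, ∑ a, (π i a - st i a) * Qfun (r i) st i a
      ≤ η * ∑ a, (π i a - st i a) * Real.log (st i a / m i a) := by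
    intro i
    refine sum_sub_mul_le_of_forall_KL_regularized_le hη (hst i) (hstI i) (hmI i) ?_ (hπm i)
    intro p hp
    rw [← Vfun_update_eq_sum_mul_Qfun, ← Vfun_eq_sum_mul_Qfun]
    exact hN i p hp
  have hi : ∀ i, ∑ a, (π i a - st i a) *
      (Qfun (r i) π i a - η * Real.log (π i a / m i a))
      ≤ Omega r i π st + -η * KL (st i) (π i) := by
    intro i
    have e : ∑ a, (π i a - st i a) * (Qfun (r i) π i a - η * Real.log (π i a / m i a))
        = ∑ a, (π i a - st i a) * Qfun (r i) π i a
          - η * ∑ a, (π i a - st i a) * Real.log (π i a / m i a) := by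
      rw [Finset.mul_sum, ← Finset.sum_sub_distrib]
      exact Finset.sum_congr rfl fun a _ => by ring
    rw [e, hQ i]
    have h1 := hopt i
    have h2 := congrArg (η * ·) (sum_sub_mul_log_sub_log_eq (hπI i) (hstI i) (hmI i))
    have h3 := mul_nonneg hη.le (KL_nonneg (hπm i) (hst i) (hπI i) (hstI i))
    linarith
  have hsum := Finset.sum_le_sum fun i (_ : i ∈ univ) => hi i
  rw [Finset.sum_add_distrib, ← Finset.mul_sum] at hsum
  exact hsum.trans (add_le_of_nonpos_left (hmono π st hπm hst))
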